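/- Suppose α ≥ 1 and n ≥ 2. Then Σ_{λ partition of n} π_α(λ)·(−1 + (n/4)·Σ_{ρ partition of n} M_α(λ,ρ)·(W_α(ρ) − W_α(λ))²)² = (3αn + 2α² − 10α + 2)/(4αn(n−1)). -/

import Mathlib

open Finset

namespace JackTest

def colLen {n : ℕ} (lam : n.Partition) (j : ℕ) : ℕ :=
  (lam.parts.filter (fun p => j < p)).card

def rowLen {n : ℕ} (lam : n.Partition) (i : ℕ) : ℕ :=
  ((Finset.range n).filter (fun j => i < colLen lam j)).card

def cells {n : ℕ} (lam : n.Partition) : Finset (ℕ × ℕ) :=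
  (Finset.range n ×ˢ Finset.range n).filter (fun s => s.2 < rowLen lam s.1)

def arm {n : ℕ} (lam : n.Partition) (s : ℕ × ℕ) : ℕ := rowLen lam s.1 - (s.2 + 1)

def leg {n : ℕ} (lam : n.Partition) (s : ℕ × ℕ) : ℕ := colLen lam s.2 - (s.1 + 1)

noncomputable def cLow (α : ℝ) {n : ℕ} (lam : n.Partition) : ℝ :=
  ∏ s ∈ cells lam, (α * arm lam s + leg lam s + 1)

noncomputable def cUp (α : ℝ) {n : ℕ} (lam : n.Partition) : ℝ :=
  ∏ s ∈ cells lam, (α * arm lam s + leg lam s + α)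

noncomputable def jackP (α : ℝ) {n : ℕ} (lam : n.Partition) : ℝ :=
  α ^ n * (n.factorial) / (cLow α lam * cUp α lam)

def nStat {n : ℕ} (lam : n.Partition) : ℕ := ∑ i ∈ Finset.range n, i * rowLen lam i

def nStatConj {n : ℕ} (lam : n.Partition) : ℕ := ∑ j ∈ Finset.range n, j * colLen lam j

noncomputable def W (α : ℝ) {n : ℕ} (lam : n.Partition) : ℝ :=
  (α * nStatConj lam - nStat lam) / Real.sqrt (α * n.choose 2)

noncomputable def Phi (x : ℝ) : ℝ :=
  (Real.sqrt (2 * Real.pi))⁻¹ * ∫ t in Set.Iic x, Real.exp (-t ^ 2 / 2)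

/-- `ψ'_{λ/τ}(α)`: zero unless `τ ⊆ λ` (the sizes `|λ| = |τ| + 1` are enforced by the types);
otherwise the product over boxes in the columns of `λ` meeting `λ - τ` but not in the rows
of `λ` meeting `λ - τ`. -/
noncomputable def psi' (α : ℝ) {n : ℕ} (lam : n.Partition) (tau : (n - 1).Partition) : ℝ :=
  if cells tau ⊆ cells lam then
    ∏ s ∈ ((cells lam).filter fun s => ∃ t ∈ cells lam \ cells tau, s.2 = t.2) \
        ((cells lam).filter fun s => ∃ t ∈ cells lam \ cells tau, s.1 = t.1),
      (α * arm lam s + leg lam s + 1) / (α * arm lam s + leg lam s + α) *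
        ((α * arm tau s + leg tau s + α) / (α * arm tau s + leg tau s + 1))
  else 0

/-- The Markov chain `M_α` on partitions of `n`. -/
noncomputable def M (α : ℝ) {n : ℕ} (lam rho : n.Partition) : ℝ :=
  cUp α lam / (α * n * cLow α rho) *
    ∑ tau : (n - 1).Partition, psi' α lam tau * psi' α rho tau * cLow α tau / cUp α tau

/-- The weight at the node `x i` of the rational function
`∏_{m < N} (z - y m) / ∏_{m ≤ N} (z - x m)`. -/
noncomputable def nodeWeight (x y : ℕ → ℝ) (N i : ℕ) : ℝ :=
  (∏ m ∈ range N, (x i - y m)) / ∏ m ∈ (range (N + 1)).erase i, (x i - x m)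

/-- The `k`-th moment of the weights `nodeWeight x y N`. -/
noncomputable def moment (x y : ℕ → ℝ) (k N : ℕ) : ℝ :=
  ∑ i ∈ range (N + 1), nodeWeight x y N i * x i ^ k

/-- The power sum of the nodes `x` minus the power sum of the zeros `y`. -/
noncomputable def superPowerSum (x y : ℕ → ℝ) (k N : ℕ) : ℝ :=
  ∑ i ∈ range (N + 1), x i ^ k - ∑ i ∈ range N, y i ^ k

lemma moment_zero {x : ℕ → ℝ} (hx : Function.Injective x) (y : ℕ → ℝ) (N : ℕ) :
    moment x y 0 N = 1 := by
  have h := Lagrange.leadingCoeff_eq_sum (s := range (N + 1)) (v := x) hx.injOn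
    (P := Lagrange.nodal (range N) y) (by simp [Lagrange.degree_nodal])
  rw [Lagrange.nodal_monic.leadingCoeff] at h
  simp only [moment, nodeWeight, pow_zero, mul_one]
  rw [h]
  simp [Lagrange.eval_nodal]

lemma nodeWeight_succ {x : ℕ → ℝ} (hx : Function.Injective x) (y : ℕ → ℝ) {N i : ℕ}
    (hi : i < N + 1) :
    nodeWeight x y (N + 1) i * (x i - x (N + 1)) = nodeWeight x y N i * (x i - y N) := by
  have hne : x i - x (N + 1) ≠ 0 := sub_ne_zero.mpr (hx.ne hi.ne)
  have hset : (range (N + 1 + 1)).erase i = insert (N + 1) ((range (N + 1)).erase i) := by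
    rw [range_add_one (n := N + 1), erase_insert_of_ne hi.ne']
  have hden : ∏ m ∈ (range (N + 1)).erase i, (x i - x m) ≠ 0 :=
    prod_ne_zero_iff.mpr fun m hm => sub_ne_zero.mpr (hx.ne (ne_of_mem_erase hm).symm)
  rw [nodeWeight, nodeWeight, hset, prod_insert (by simp), prod_range_succ]
  field_simp

lemma moment_succ {x : ℕ → ℝ} (hx : Function.Injective x) (y : ℕ → ℝ) (k N : ℕ) :
    moment x y (k + 1) (N + 1) =
      x (N + 1) * moment x y k (N + 1) + moment x y (k + 1) N - y N * moment x y k N := by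
  have h : ∑ i ∈ range (N + 1 + 1), nodeWeight x y (N + 1) i * (x i - x (N + 1)) * x i ^ k =
      ∑ i ∈ range (N + 1), nodeWeight x y N i * (x i - y N) * x i ^ k := by
    rw [sum_range_succ, sub_self, mul_zero, zero_mul, add_zero]
    refine sum_congr rfl fun i hi => ?_
    rw [nodeWeight_succ hx y (mem_range.mp hi)]
  have e1 : ∑ i ∈ range (N + 1 + 1), nodeWeight x y (N + 1) i * (x i - x (N + 1)) * x i ^ k =
      moment x y (k + 1) (N + 1) - x (N + 1) * moment x y k (N + 1) := by
    rw [moment, moment, mul_sum, ← sum_sub_distrib]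
    exact sum_congr rfl fun i _ => by ring
  have e2 : ∑ i ∈ range (N + 1), nodeWeight x y N i * (x i - y N) * x i ^ k =
      moment x y (k + 1) N - y N * moment x y k N := by
    rw [moment, moment, mul_sum, ← sum_sub_distrib]
    exact sum_congr rfl fun i _ => by ring
  linarith

lemma superPowerSum_succ (x y : ℕ → ℝ) (k N : ℕ) :
    superPowerSum x y k (N + 1) = superPowerSum x y k N + x (N + 1) ^ k - y N ^ k := by
  rw [superPowerSum, superPowerSum, sum_range_succ _ (N + 1),
    sum_range_succ (fun i => y i ^ k) N]
  ring

lemma moment_at_zero (x y : ℕ → ℝ) (k : ℕ) : moment x y k 0 = x 0 ^ k := by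
  simp [moment, nodeWeight]

lemma superPowerSum_at_zero (x y : ℕ → ℝ) (k : ℕ) : superPowerSum x y k 0 = x 0 ^ k := by
  simp [superPowerSum]

/-- Newton's identities for the moments of order at most four. -/
lemma moment_eq {x : ℕ → ℝ} (hx : Function.Injective x) (y : ℕ → ℝ) (N : ℕ) :
    moment x y 1 N = superPowerSum x y 1 N ∧
    moment x y 2 N = (superPowerSum x y 1 N ^ 2 + superPowerSum x y 2 N) / 2 ∧
    moment x y 3 N = (superPowerSum x y 1 N ^ 3 +
      3 * superPowerSum x y 1 N * superPowerSum x y 2 N + 2 * superPowerSum x y 3 N) / 6 ∧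
    moment x y 4 N = (superPowerSum x y 1 N ^ 4 +
      6 * superPowerSum x y 1 N ^ 2 * superPowerSum x y 2 N + 3 * superPowerSum x y 2 N ^ 2 +
      8 * superPowerSum x y 1 N * superPowerSum x y 3 N + 6 * superPowerSum x y 4 N) / 24 := by
  induction N with
  | zero =>
    simp only [moment_at_zero, superPowerSum_at_zero]
    refine ⟨trivial, ?_, ?_, ?_⟩ <;> ring
  | succ N ih =>
    obtain ⟨h1, h2, h3, h4⟩ := ih
    have g1 := moment_succ hx y 0 N
    have g2 := moment_succ hx y 1 N
    have g3 := moment_succ hx y 2 N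
    have g4 := moment_succ hx y 3 N
    norm_num only at g1 g2 g3 g4
    rw [moment_zero hx, moment_zero hx] at g1
    simp only [superPowerSum_succ]
    rw [g4, g3, g2, g1, h1, h2, h3, h4]
    refine ⟨?_, ?_, ?_, ?_⟩ <;> ring

lemma lt_card_iff_mem_of_lower {S : Finset ℕ} (hS : ∀ a ∈ S, ∀ b < a, b ∈ S) (j : ℕ) :
    j < #S ↔ j ∈ S := by
  constructor
  · intro h
    by_contra hj
    have hsub : S ⊆ range j := fun a ha => by
      rw [mem_range]
      by_contra hja
      rcases (not_lt.mp hja).eq_or_lt with rfl | hlt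
      · exact hj ha
      · exact hj (hS a ha j hlt)
    have := card_le_card hsub
    rw [card_range] at this
    omega
  · intro h
    have hsub : range (j + 1) ⊆ S := fun a ha => by
      rcases (Nat.lt_succ_iff.mp (mem_range.mp ha)).eq_or_lt with rfl | hlt
      · exact h
      · exact hS j h a hlt
    have := card_le_card hsub
    rw [card_range] at this
    omega

section Shape

variable {n : ℕ} (lam : n.Partition)

lemma colLen_anti {j k : ℕ} (h : j ≤ k) : colLen lam k ≤ colLen lam j :=
  Multiset.card_le_card
    (Multiset.monotone_filter_right _ fun _ hp => lt_of_le_of_lt h hp)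

lemma colLen_eq_zero {j : ℕ} (h : n ≤ j) : colLen lam j = 0 := by
  rw [colLen, Multiset.card_eq_zero, Multiset.filter_eq_nil]
  intro p hp
  have := Nat.Partition.le_of_mem_parts hp
  omega

lemma colLen_le (j : ℕ) : colLen lam j ≤ n := by
  calc colLen lam j ≤ Multiset.card lam.parts := Multiset.card_le_card (Multiset.filter_le _ _)
    _ = (Multiset.map (fun _ => 1) lam.parts).sum := by simp
    _ ≤ (Multiset.map id lam.parts).sum :=
      Multiset.sum_map_le_sum_map _ _ fun p hp => lam.parts_pos hp
    _ = n := by rw [Multiset.map_id, lam.parts_sum]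

lemma lt_rowLen_iff (i j : ℕ) : j < rowLen lam i ↔ i < colLen lam j := by
  rw [rowLen, lt_card_iff_mem_of_lower]
  · rw [mem_filter, mem_range, and_iff_right_iff_imp]
    intro h
    by_contra hj
    rw [colLen_eq_zero lam (not_lt.mp hj)] at h
    omega
  · intro a ha b hb
    rw [mem_filter, mem_range] at ha ⊢
    exact ⟨hb.trans ha.1, ha.2.trans_le (colLen_anti lam hb.le)⟩

lemma rowLen_anti {i k : ℕ} (h : i ≤ k) : rowLen lam k ≤ rowLen lam i := by
  by_contra! hlt
  have h1 := (lt_rowLen_iff lam k _).mp hlt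
  have h2 := (lt_rowLen_iff lam i (rowLen lam i)).mpr (h.trans_lt h1)
  omega

lemma rowLen_eq_zero {i : ℕ} (h : n ≤ i) : rowLen lam i = 0 := by
  by_contra h0
  have h1 := (lt_rowLen_iff lam i 0).mp (Nat.pos_of_ne_zero h0)
  have := colLen_le lam 0
  omega

lemma mem_cells (s : ℕ × ℕ) : s ∈ cells lam ↔ s.2 < rowLen lam s.1 := by
  rw [cells, mem_filter, mem_product, mem_range, mem_range, and_iff_right_iff_imp]
  intro h
  have h1 := (lt_rowLen_iff lam _ _).mp h
  constructor
  · exact h1.trans_le (colLen_le lam _)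
  · by_contra hj
    rw [colLen_eq_zero lam (not_lt.mp hj)] at h1
    omega

lemma mem_cells' (s : ℕ × ℕ) : s ∈ cells lam ↔ s.1 < colLen lam s.2 := by
  rw [mem_cells, lt_rowLen_iff]

lemma sum_cells {A : Type*} [AddCommMonoid A] (f : ℕ × ℕ → A) :
    ∑ s ∈ cells lam, f s = ∑ i ∈ range n, ∑ j ∈ range (rowLen lam i), f (i, j) := by
  rw [sum_sigma', sum_bij' (fun s _ => (⟨s.1, s.2⟩ : Σ _ : ℕ, ℕ)) (fun s _ => (s.1, s.2))]
  · intro s hs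
    have := (mem_filter.mp hs)
    simp only [mem_sigma, mem_range]
    exact ⟨mem_range.mp (mem_product.mp this.1).1, this.2⟩
  · intro s hs
    rw [mem_cells]
    exact mem_range.mp (mem_sigma.mp hs).2
  all_goals intros; rfl

lemma sum_cells' {A : Type*} [AddCommMonoid A] (f : ℕ × ℕ → A) :
    ∑ s ∈ cells lam, f s = ∑ j ∈ range n, ∑ i ∈ range (colLen lam j), f (i, j) := by
  rw [sum_sigma', sum_bij' (fun s _ => (⟨s.2, s.1⟩ : Σ _ : ℕ, ℕ)) (fun s _ => (s.2, s.1))]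
  · intro s hs
    have := (mem_filter.mp hs)
    simp only [mem_sigma, mem_range]
    exact ⟨mem_range.mp (mem_product.mp this.1).2, (mem_cells' lam s).mp hs⟩
  · intro s hs
    rw [mem_cells']
    exact mem_range.mp (mem_sigma.mp hs).2
  all_goals intros; rfl

lemma sum_card_filter_lt (s : Multiset ℕ) (N : ℕ) (h : ∀ p ∈ s, p ≤ N) :
    ∑ j ∈ range N, Multiset.card (s.filter fun p => j < p) = s.sum := by
  induction s using Multiset.induction with
  | empty => simp
  | cons a s ih =>
    have ha : a ≤ N := h a (Multiset.mem_cons_self a s)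
    have hf : (range N).filter (fun j => j < a) = range a := by
      ext j
      simp only [mem_filter, mem_range]
      omega
    rw [Multiset.sum_cons, ← ih fun p hp => h p (Multiset.mem_cons_of_mem hp)]
    simp only [Multiset.filter_cons, Multiset.card_add, sum_add_distrib, apply_ite Multiset.card,
      Multiset.card_singleton, Multiset.card_zero]
    rw [← card_filter, hf, card_range]

lemma card_cells : #(cells lam) = n := by
  rw [card_eq_sum_ones, sum_cells']
  simp only [sum_const, card_range, smul_eq_mul, mul_one, colLen]
  rw [sum_card_filter_lt _ _ fun p hp => Nat.Partition.le_of_mem_parts hp, lam.parts_sum]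

lemma sum_rowLen : ∑ i ∈ range n, rowLen lam i = n := by
  have h := card_cells lam
  rw [card_eq_sum_ones, sum_cells] at h
  simpa using h

end Shape

lemma colLen_eq_add_count {n : ℕ} (lam : n.Partition) (j : ℕ) :
    colLen lam j = colLen lam (j + 1) + lam.parts.count (j + 1) := by
  rw [colLen, colLen, Multiset.count, Multiset.countP_eq_card_filter]
  induction lam.parts using Multiset.induction with
  | empty => simp
  | cons a s ih =>
    simp only [Multiset.filter_cons, Multiset.card_add, apply_ite Multiset.card,
      Multiset.card_singleton, Multiset.card_zero]
    split_ifs <;> omega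

lemma eq_of_rowLen_eq {n : ℕ} {lam mu : n.Partition} (h : ∀ i, rowLen lam i = rowLen mu i) :
    lam = mu := by
  have hc : ∀ j, colLen lam j = colLen mu j := by
    intro j
    by_contra hne
    rcases Nat.lt_or_gt_of_ne hne with hlt | hlt
    · have := (lt_rowLen_iff mu _ _).mpr hlt
      rw [← h, lt_rowLen_iff] at this
      omega
    · have := (lt_rowLen_iff lam _ _).mpr hlt
      rw [h, lt_rowLen_iff] at this
      omega
  apply Nat.Partition.ext
  ext p
  rcases p with _ | j
  · rw [Multiset.count_eq_zero_of_notMem fun h0 => (lam.parts_pos h0).ne rfl,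
      Multiset.count_eq_zero_of_notMem fun h0 => (mu.parts_pos h0).ne rfl]
  · have h1 := colLen_eq_add_count lam j
    have h2 := colLen_eq_add_count mu j
    rw [hc, hc] at h1
    omega

lemma exists_rowLen_eq {n : ℕ} (r : ℕ → ℕ) (hr : Antitone r)
    (hsum : ∑ i ∈ range n, r i = n) (hz : r n = 0) : ∃ lam : n.Partition, rowLen lam = r := by
  have hsum' : ((range n).val.map r).sum = n := hsum
  refine ⟨Nat.Partition.ofSums n ((range n).val.map r) hsum', ?_⟩
  set lam := Nat.Partition.ofSums n ((range n).val.map r) hsum' with hlam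
  have hcol : ∀ j, colLen lam j = #((range n).filter fun i => j < r i) := by
    intro j
    rw [colLen, hlam, Nat.Partition.ofSums_parts, Multiset.filter_filter, Multiset.filter_map,
      Multiset.card_map, card_def, filter_val]
    congr 1
    apply Multiset.filter_congr
    intro i _
    simp only [Function.comp_apply]
    omega
  have hiff : ∀ i j, j < rowLen lam i ↔ j < r i := by
    intro i j
    rw [lt_rowLen_iff, hcol, lt_card_iff_mem_of_lower, mem_filter, mem_range,
      and_iff_right_iff_imp]
    · intro h
      by_contra hi
      have := hr (not_lt.mp hi)
      omega
    · intro a ha b hb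
      rw [mem_filter, mem_range] at ha ⊢
      exact ⟨hb.trans ha.1, ha.2.trans_le (hr hb.le)⟩
  funext i
  have h1 := hiff i (rowLen lam i)
  have h2 := hiff i (r i)
  omega

/-- `rho` is obtained from `tau` by adding one box at the end of row `i`. -/
def AddsBox {n m : ℕ} (tau : m.Partition) (rho : n.Partition) (i : ℕ) : Prop :=
  ∀ k, rowLen rho k = rowLen tau k + if k = i then 1 else 0

section AddsBox

variable {n m : ℕ} {tau : m.Partition} {rho : n.Partition} {i : ℕ}

lemma exists_addsBox_of_subset (hnm : n = m + 1) (h : cells tau ⊆ cells rho) :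
    ∃ i < n, AddsBox tau rho i := by
  have hcard : #(cells rho \ cells tau) = 1 := by
    rw [card_sdiff_of_subset h, card_cells, card_cells]
    omega
  obtain ⟨t, ht⟩ := card_eq_one.mp hcard
  have hmem : ∀ k j, j < rowLen rho k ↔ j < rowLen tau k ∨ (k = t.1 ∧ j = t.2) := by
    intro k j
    have h1 : (k, j) ∈ cells rho \ cells tau ↔ (k, j) = t := by rw [ht, mem_singleton]
    have h2 := @h (k, j)
    rw [mem_sdiff, Prod.ext_iff] at h1
    rw [← mem_cells rho (k, j), ← mem_cells tau (k, j)]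
    tauto
  have ht' : t ∈ cells rho \ cells tau := by rw [ht, mem_singleton]
  rw [mem_sdiff, mem_cells, mem_cells] at ht'
  refine ⟨t.1, ?_, fun k => ?_⟩
  · exact ((lt_rowLen_iff rho _ _).mp ht'.1).trans_le (colLen_le rho _)
  · have e1 := hmem k (rowLen tau k)
    have e2 := hmem k (rowLen rho k)
    have e3 := hmem k (rowLen tau k + 1)
    split_ifs with hk
    · subst hk
      omega
    · omega

lemma AddsBox.mem_cells (h : AddsBox tau rho i) (s : ℕ × ℕ) :
    s ∈ cells rho ↔ s = (i, rowLen tau i) ∨ s ∈ cells tau := by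
  rw [JackTest.mem_cells, JackTest.mem_cells, h, Prod.ext_iff]
  split_ifs with hs
  · rw [hs]
    simp only [true_and]
    omega
  · simp [hs]

lemma AddsBox.subset (h : AddsBox tau rho i) : cells tau ⊆ cells rho :=
  fun s hs => (h.mem_cells s).mpr (Or.inr hs)

lemma AddsBox.cells_eq (h : AddsBox tau rho i) :
    cells rho = insert (i, rowLen tau i) (cells tau) := by
  ext s
  rw [h.mem_cells, mem_insert]

lemma corner_notMem (tau : m.Partition) (i : ℕ) : (i, rowLen tau i) ∉ cells tau := by
  simp [JackTest.mem_cells]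

lemma AddsBox.lt_rowLen_of_lt (h : AddsBox tau rho i) {k : ℕ} (hk : k < i) :
    rowLen tau i < rowLen tau k := by
  have h1 := h k
  have h2 := h i
  have h3 := rowLen_anti rho hk.le
  simp only [hk.ne, if_true, if_false] at h1 h2
  omega

lemma AddsBox.colLen_corner (h : AddsBox tau rho i) : colLen tau (rowLen tau i) = i := by
  have h1 := (lt_rowLen_iff tau i (rowLen tau i)).not.mp (lt_irrefl _)
  by_contra hne
  have h2 := h.lt_rowLen_of_lt (k := colLen tau (rowLen tau i)) (by omega)
  rw [lt_rowLen_iff] at h2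
  omega

lemma AddsBox.colLen_eq (h : AddsBox tau rho i) (j : ℕ) :
    colLen rho j = colLen tau j + if j = rowLen tau i then 1 else 0 := by
  have hk : ∀ k, k < colLen rho j ↔ k < colLen tau j ∨ (k = i ∧ j = rowLen tau i) := by
    intro k
    have := h.mem_cells (k, j)
    rw [mem_cells', mem_cells', Prod.ext_iff] at this
    tauto
  have hc := h.colLen_corner
  have e1 := hk (colLen tau j)
  have e2 := hk (colLen rho j)
  have e3 := hk (colLen tau j + 1)
  split_ifs with hj
  · subst hj
    omega
  · omega

lemma AddsBox.index_unique {i' : ℕ} (h : AddsBox tau rho i) (h' : AddsBox tau rho i') :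
    i = i' := by
  have h1 := h i
  have h2 := h' i
  by_contra hne
  simp only [hne, if_true, if_false] at h1 h2
  omega

lemma AddsBox.upper_unique {rho' : n.Partition} (h : AddsBox tau rho i)
    (h' : AddsBox tau rho' i) : rho = rho' :=
  eq_of_rowLen_eq fun k => by rw [h k, h' k]

lemma AddsBox.lower_unique {tau' : m.Partition} (h : AddsBox tau rho i)
    (h' : AddsBox tau' rho i) : tau = tau' :=
  eq_of_rowLen_eq fun k => by
    have h1 := h k
    have h2 := h' k
    omega

lemma exists_addsBox_upper (hnm : n = m + 1) (tau : m.Partition) {i : ℕ} (hi : i < n)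
    (hadd : ∀ k, i = k + 1 → rowLen tau i < rowLen tau k) :
    ∃ rho : n.Partition, AddsBox tau rho i := by
  obtain ⟨rho, hrho⟩ := exists_rowLen_eq (n := n)
    (fun k => rowLen tau k + if k = i then 1 else 0)
    (antitone_nat_of_succ_le fun k => by
      have h1 := rowLen_anti tau (Nat.le_add_right k 1)
      have h2 := hadd k
      split_ifs with h3 h4
      · omega
      · rw [← h3] at h2
        have := h2 rfl
        omega
      · omega
      · omega)
    (by
      have h1 := sum_rowLen tau
      have h2 := rowLen_eq_zero tau (le_refl m)
      rw [sum_add_distrib, sum_ite_eq', if_pos (mem_range.mpr hi), hnm, sum_range_succ, h1, h2])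
    (by
      have h2 := rowLen_eq_zero tau (i := n) (by omega)
      simp [h2, hi.ne'])
  exact ⟨rho, fun k => by rw [hrho]⟩

lemma exists_addsBox_lower (hnm : n = m + 1) (lam : n.Partition) {i : ℕ} (hi : i < n)
    (hrem : rowLen lam (i + 1) < rowLen lam i) :
    ∃ tau : m.Partition, AddsBox tau lam i := by
  set r : ℕ → ℕ := fun k => rowLen lam k - if k = i then 1 else 0 with hr
  have hlam : ∀ k, rowLen lam k = r k + if k = i then 1 else 0 := by
    intro k
    simp only [hr]
    split_ifs with hk
    · subst hk
      omega
    · omega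
  have hanti : Antitone r := antitone_nat_of_succ_le fun k => by
    have h1 := rowLen_anti lam (Nat.le_add_right k 1)
    simp only [hr]
    split_ifs with h3 h4 h4
    · omega
    · omega
    · subst h4
      omega
    · omega
  have hsum : ∑ k ∈ range n, r k = m := by
    have h1 := sum_rowLen lam
    simp only [hlam] at h1
    rw [sum_add_distrib, sum_ite_eq', if_pos (mem_range.mpr hi)] at h1
    omega
  have hz : r m = 0 := by
    by_contra h0
    have h1 : ∑ k ∈ range n, 1 ≤ ∑ k ∈ range n, r k := sum_le_sum fun k hk => by
      have := hanti (show k ≤ m by rw [mem_range] at hk; omega)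
      omega
    rw [hsum, sum_const, card_range, smul_eq_mul, mul_one] at h1
    omega
  obtain ⟨tau, htau⟩ := exists_rowLen_eq (n := m) r hanti
    (by rw [hnm, sum_range_succ, hz] at hsum; exact hsum) hz
  exact ⟨tau, fun k => by rw [htau, hlam]⟩

end AddsBox

section Hooks

variable {n m : ℕ} {tau : m.Partition} {rho : n.Partition} {i : ℕ}

lemma AddsBox.arm_eq (h : AddsBox tau rho i) {s : ℕ × ℕ} (hs : s ∈ cells tau) :
    arm rho s = arm tau s + if s.1 = i then 1 else 0 := by
  rw [JackTest.mem_cells] at hs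
  rw [arm, arm, h]
  omega

lemma AddsBox.leg_eq (h : AddsBox tau rho i) {s : ℕ × ℕ} (hs : s ∈ cells tau) :
    leg rho s = leg tau s + if s.2 = rowLen tau i then 1 else 0 := by
  rw [mem_cells'] at hs
  rw [leg, leg, h.colLen_eq]
  omega

lemma prod_cells_row (tau : m.Partition) (i : ℕ) (g : ℕ × ℕ → ℝ) :
    ∏ s ∈ cells tau with s.1 = i, g s = ∏ j ∈ range (rowLen tau i), g (i, j) := by
  refine prod_bij' (fun s _ => s.2) (fun j _ => (i, j)) ?_ ?_ ?_ ?_ ?_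
  · rintro ⟨a, b⟩ hs
    rw [mem_filter, JackTest.mem_cells] at hs
    obtain ⟨h1, rfl⟩ := hs
    exact mem_range.mpr h1
  · intro j hj
    rw [mem_filter, JackTest.mem_cells]
    exact ⟨mem_range.mp hj, rfl⟩
  · rintro ⟨a, b⟩ hs
    rw [mem_filter] at hs
    obtain ⟨-, rfl⟩ := hs
    rfl
  · intros
    rfl
  · rintro ⟨a, b⟩ hs
    rw [mem_filter] at hs
    obtain ⟨-, rfl⟩ := hs
    rfl

lemma prod_cells_col (tau : m.Partition) (j : ℕ) (g : ℕ × ℕ → ℝ) :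
    ∏ s ∈ cells tau with s.2 = j, g s = ∏ k ∈ range (colLen tau j), g (k, j) := by
  refine prod_bij' (fun s _ => s.1) (fun k _ => (k, j)) ?_ ?_ ?_ ?_ ?_
  · rintro ⟨a, b⟩ hs
    rw [mem_filter, mem_cells'] at hs
    obtain ⟨h1, rfl⟩ := hs
    exact mem_range.mpr h1
  · intro k hk
    rw [mem_filter, mem_cells']
    exact ⟨mem_range.mp hk, rfl⟩
  · rintro ⟨a, b⟩ hs
    rw [mem_filter] at hs
    obtain ⟨-, rfl⟩ := hs
    rfl
  · intros
    rfl
  · rintro ⟨a, b⟩ hs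
    rw [mem_filter] at hs
    obtain ⟨-, rfl⟩ := hs
    rfl

/-- Adding a box changes a product over hooks only in the row and in the column of the box. -/
lemma AddsBox.prod_hooks (h : AddsBox tau rho i) (F : ℕ → ℕ → ℝ) (hF : ∀ a l, F a l ≠ 0) :
    ∏ s ∈ cells rho, F (arm rho s) (leg rho s) =
      F 0 0 *
        (∏ j ∈ range (rowLen tau i),
          F (arm tau (i, j) + 1) (leg tau (i, j)) / F (arm tau (i, j)) (leg tau (i, j))) *
        (∏ k ∈ range i, F (arm tau (k, rowLen tau i)) (leg tau (k, rowLen tau i) + 1) /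
          F (arm tau (k, rowLen tau i)) (leg tau (k, rowLen tau i))) *
        ∏ s ∈ cells tau, F (arm tau s) (leg tau s) := by
  have harm : arm rho (i, rowLen tau i) = 0 := by simp [arm, h i]
  have hleg : leg rho (i, rowLen tau i) = 0 := by simp [leg, h.colLen_eq, h.colLen_corner]
  rw [h.cells_eq, prod_insert (corner_notMem tau i), harm, hleg]
  have hrow := prod_cells_row tau i fun s =>
    F (arm tau s + 1) (leg tau s) / F (arm tau s) (leg tau s)
  have hcol := prod_cells_col tau (rowLen tau i) fun s =>
    F (arm tau s) (leg tau s + 1) / F (arm tau s) (leg tau s)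
  rw [h.colLen_corner] at hcol
  rw [← hrow, ← hcol, prod_filter, prod_filter, mul_assoc, mul_assoc, ← prod_mul_distrib,
    ← prod_mul_distrib]
  congr 1
  refine prod_congr rfl fun s hs => ?_
  rw [h.arm_eq hs, h.leg_eq hs]
  have h0 := hF (arm tau s) (leg tau s)
  by_cases h1 : s.1 = i
  · have h2 : s.2 ≠ rowLen tau i := by
      rw [JackTest.mem_cells, h1] at hs
      exact hs.ne
    simp only [h1, h2, if_true, if_false, add_zero, one_mul]
    field_simp
  · by_cases h2 : s.2 = rowLen tau i
    · simp only [h1, if_false, add_zero, one_mul, if_pos h2]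
      field_simp
    · simp only [h1, h2, if_false, add_zero, one_mul]

/-- The coefficient `ψ'` for partitions of arbitrary sizes. -/
noncomputable def psiGen (α : ℝ) (lam : n.Partition) (tau : m.Partition) : ℝ :=
  if cells tau ⊆ cells lam then
    ∏ s ∈ ((cells lam).filter fun s => ∃ t ∈ cells lam \ cells tau, s.2 = t.2) \
        ((cells lam).filter fun s => ∃ t ∈ cells lam \ cells tau, s.1 = t.1),
      (α * arm lam s + leg lam s + 1) / (α * arm lam s + leg lam s + α) *
        ((α * arm tau s + leg tau s + α) / (α * arm tau s + leg tau s + 1))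
  else 0

lemma AddsBox.psiGen_eq (h : AddsBox tau rho i) (α : ℝ) :
    psiGen α rho tau = ∏ k ∈ range i,
      ((α * arm tau (k, rowLen tau i) + (leg tau (k, rowLen tau i) + 1 : ℕ) + 1) /
        (α * arm tau (k, rowLen tau i) + (leg tau (k, rowLen tau i) + 1 : ℕ) + α) *
        ((α * arm tau (k, rowLen tau i) + leg tau (k, rowLen tau i) + α) /
          (α * arm tau (k, rowLen tau i) + leg tau (k, rowLen tau i) + 1))) := by
  rw [psiGen, if_pos h.subset]
  have hdiff : cells rho \ cells tau = {(i, rowLen tau i)} := by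
    rw [h.cells_eq, insert_sdiff_of_notMem _ (corner_notMem tau i), sdiff_self]
    rfl
  have hset : ((cells rho).filter fun s => ∃ t ∈ cells rho \ cells tau, s.2 = t.2) \
      ((cells rho).filter fun s => ∃ t ∈ cells rho \ cells tau, s.1 = t.1) =
      (cells tau).filter fun s => s.2 = rowLen tau i := by
    rw [hdiff]
    ext s
    simp only [mem_sdiff, mem_filter, mem_singleton, exists_eq_left, h.mem_cells]
    rw [Prod.ext_iff]
    have h1 := JackTest.mem_cells tau s
    constructor
    · rintro ⟨⟨h2 | h2, h3⟩, h4⟩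
      · tauto
      · exact ⟨h2, h3⟩
    · rintro ⟨h2, h3⟩
      refine ⟨⟨Or.inr h2, h3⟩, fun h4 => ?_⟩
      have h5 := h1.mp h2
      rw [h4.2] at h5
      omega
  rw [hset]
  have hcol := prod_cells_col tau (rowLen tau i) fun s =>
      ((α * arm tau s + (leg tau s + 1 : ℕ) + 1) / (α * arm tau s + (leg tau s + 1 : ℕ) + α) *
        ((α * arm tau s + leg tau s + α) / (α * arm tau s + leg tau s + 1)))
  rw [h.colLen_corner] at hcol
  rw [← hcol]
  refine prod_congr rfl fun s hs => ?_
  obtain ⟨hs1, hs2⟩ := mem_filter.mp hs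
  have hne : s.1 ≠ i := by
    rintro rfl
    rw [JackTest.mem_cells] at hs1
    omega
  rw [h.arm_eq hs1, h.leg_eq hs1, if_neg hne, if_pos hs2, add_zero]

lemma hook_pos {α : ℝ} (hα : 0 < α) {c : ℝ} (hc : 0 < c) (a l : ℕ) : 0 < α * a + l + c := by
  positivity

lemma cLow_pos {α : ℝ} (hα : 0 < α) (tau : m.Partition) : 0 < cLow α tau :=
  prod_pos fun _ _ => hook_pos hα one_pos _ _

lemma cUp_pos {α : ℝ} (hα : 0 < α) (tau : m.Partition) : 0 < cUp α tau :=
  prod_pos fun _ _ => hook_pos hα hα _ _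

lemma AddsBox.up_eq_prod (h : AddsBox tau rho i) {α : ℝ} (hα : 0 < α) :
    psiGen α rho tau * cLow α tau / cLow α rho =
      (∏ j ∈ range (rowLen tau i), (α * arm tau (i, j) + leg tau (i, j) + 1) /
        (α * (arm tau (i, j) + 1 : ℕ) + leg tau (i, j) + 1)) *
      ∏ k ∈ range i, (α * arm tau (k, rowLen tau i) + leg tau (k, rowLen tau i) + α) /
        (α * arm tau (k, rowLen tau i) + (leg tau (k, rowLen tau i) + 1 : ℕ) + α) := by
  have hlow := h.prod_hooks (fun a l => α * a + l + 1) fun a l => (hook_pos hα one_pos a l).ne'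
  have hpsi := h.psiGen_eq α
  have hpos := (cLow_pos hα tau).ne'
  change cLow α rho = _ * cLow α tau at hlow
  rw [hlow, hpsi]
  simp only [Nat.cast_zero, mul_zero, zero_add, one_mul]
  rw [mul_div_mul_right _ _ hpos, div_eq_iff]
  · have hone : (∏ j ∈ range (rowLen tau i), (α * arm tau (i, j) + leg tau (i, j) + 1) /
        (α * (arm tau (i, j) + 1 : ℕ) + leg tau (i, j) + 1)) *
        (∏ j ∈ range (rowLen tau i), (α * (arm tau (i, j) + 1 : ℕ) + leg tau (i, j) + 1) /
          (α * arm tau (i, j) + leg tau (i, j) + 1)) = 1 := by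
      rw [← prod_mul_distrib]
      refine prod_eq_one fun j _ => ?_
      have h1 := (hook_pos hα one_pos (arm tau (i, j)) (leg tau (i, j))).ne'
      have h2 := (hook_pos hα one_pos (arm tau (i, j) + 1) (leg tau (i, j))).ne'
      field_simp
    rw [mul_mul_mul_comm, hone, one_mul, ← prod_mul_distrib]
    refine prod_congr rfl fun k _ => ?_
    ring
  · refine mul_ne_zero ?_ ?_ <;> refine prod_ne_zero_iff.mpr fun _ _ => div_ne_zero ?_ ?_ <;>
      exact (hook_pos hα one_pos _ _).ne'

lemma AddsBox.down_eq_prod (h : AddsBox tau rho i) {α : ℝ} (hα : 0 < α) :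
    cUp α rho * psiGen α rho tau / cUp α tau =
      α * (∏ j ∈ range (rowLen tau i), (α * (arm tau (i, j) + 1 : ℕ) + leg tau (i, j) + α) /
        (α * arm tau (i, j) + leg tau (i, j) + α)) *
      ∏ k ∈ range i,
        (α * arm tau (k, rowLen tau i) + (leg tau (k, rowLen tau i) + 1 : ℕ) + 1) /
        (α * arm tau (k, rowLen tau i) + leg tau (k, rowLen tau i) + 1) := by
  have hup := h.prod_hooks (fun a l => α * a + l + α) fun a l => (hook_pos hα hα a l).ne'
  have hpsi := h.psiGen_eq α
  have hpos := (cUp_pos hα tau).ne'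
  change cUp α rho = _ * cUp α tau at hup
  rw [hup, hpsi]
  simp only [Nat.cast_zero, mul_zero, zero_add]
  rw [div_eq_iff hpos, mul_right_comm, mul_assoc (α * _), ← prod_mul_distrib]
  congr 2
  refine prod_congr rfl fun k _ => ?_
  have h1 := (hook_pos hα hα (arm tau (k, rowLen tau i)) (leg tau (k, rowLen tau i))).ne'
  have h2 := (hook_pos hα hα (arm tau (k, rowLen tau i)) (leg tau (k, rowLen tau i) + 1)).ne'
  field_simp

end Hooks

lemma prod_Ico_div_succ {f : ℕ → ℝ} {a b : ℕ} (hab : a ≤ b) (hf : ∀ j ≤ b, f j ≠ 0) :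
    ∏ j ∈ Ico a b, f j / f (j + 1) = f a / f b := by
  induction b, hab using Nat.le_induction with
  | base => rw [Ico_self, prod_empty, div_self (hf a le_rfl)]
  | succ b hab ih =>
    rw [prod_Ico_succ_top hab, ih fun j hj => hf j (by omega),
      div_mul_div_cancel₀ (hf b (by omega))]

lemma prod_erase_range (f : ℕ → ℝ) {i N : ℕ} (hi : i < N) :
    ∏ k ∈ (range N).erase i, f k = (∏ k ∈ range i, f k) * ∏ k ∈ Ico (i + 1) N, f k := by
  rw [← prod_union]
  · congr 1
    ext k
    simp only [mem_erase, mem_range, mem_union, mem_Ico]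
    omega
  · rw [disjoint_left]
    intro k
    simp only [mem_range, mem_Ico]
    omega

section Telescoping

variable {m : ℕ} (tau : m.Partition) (α z : ℝ)

lemma prod_columns_succ (p : ℕ) (hz : ∀ j ≤ rowLen tau p, z - α * j + (p + 1 : ℕ) ≠ 0) :
    ∏ j ∈ range (rowLen tau p),
      (z - α * j + colLen tau j) / (z - α * (j + 1 : ℕ) + colLen tau j) =
    (∏ j ∈ range (rowLen tau (p + 1)),
      (z - α * j + colLen tau j) / (z - α * (j + 1 : ℕ) + colLen tau j)) *
    ((z - α * rowLen tau (p + 1) + (p + 1 : ℕ)) / (z - α * rowLen tau p + (p + 1 : ℕ))) := by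
  have hle := rowLen_anti tau (Nat.le_add_right p 1)
  rw [← prod_range_mul_prod_Ico _ hle]
  congr 1
  rw [← prod_Ico_div_succ (f := fun j : ℕ => z - α * j + (p + 1 : ℕ)) hle hz]
  refine prod_congr rfl fun j hj => ?_
  rw [mem_Ico] at hj
  have h1 := (lt_rowLen_iff tau p j).mp hj.2
  have h2 := (lt_rowLen_iff tau (p + 1) j).not.mp (by omega)
  rw [show colLen tau j = p + 1 by omega]

/-- Telescoping along the part of the boundary of a diagram from row `p` downwards. -/
lemma prod_boundary {N : ℕ} (hN : m ≤ N) {p : ℕ} (hp : p ≤ N)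
    (hz : ∀ i j : ℕ, p ≤ i → j ≤ rowLen tau p → z - α * j + i ≠ 0) :
    (∏ j ∈ range (rowLen tau p),
      (z - α * j + colLen tau j) / (z - α * (j + 1 : ℕ) + colLen tau j)) *
    ∏ i ∈ Ico p N, (z - α * rowLen tau i + (i + 1 : ℕ)) / (z - α * rowLen tau i + i) =
    (z + N) / (z - α * rowLen tau p + p) := by
  induction hp using Nat.decreasingInduction with
  | self =>
    have h0 := hz N 0 le_rfl (Nat.zero_le _)
    simp only [rowLen_eq_zero tau hN, Nat.cast_zero, mul_zero, sub_zero] at h0 ⊢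
    simp [div_self h0]
  | of_succ p hp ih =>
    have hle := rowLen_anti tau (Nat.le_add_right p 1)
    have ih' := ih fun i j hi hj => hz i j (by omega) (hj.trans hle)
    have h1 := hz (p + 1) (rowLen tau p) (by omega) le_rfl
    have h3 := hz (p + 1) (rowLen tau (p + 1)) (by omega) hle
    rw [prod_columns_succ tau α z p fun j hj => hz _ j (by omega) hj,
      prod_eq_prod_Ico_succ_bot hp]
    rw [← div_mul_div_cancel₀ (a := z + N) h3, ← ih', ← div_mul_div_cancel₀
      (a := z - α * rowLen tau (p + 1) + (p + 1 : ℕ)) (c := z - α * rowLen tau p + p) h1]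
    ring

lemma prod_boundary_succ {N : ℕ} (hN : m ≤ N) {p : ℕ} (hp : p < N)
    (hz : ∀ i j : ℕ, p < i → j ≤ rowLen tau p → z - α * j + i ≠ 0) :
    (∏ j ∈ range (rowLen tau p),
      (z - α * j + colLen tau j) / (z - α * (j + 1 : ℕ) + colLen tau j)) *
    ∏ i ∈ Ico (p + 1) N, (z - α * rowLen tau i + (i + 1 : ℕ)) / (z - α * rowLen tau i + i) =
    (z + N) / (z - α * rowLen tau p + (p + 1 : ℕ)) := by
  have hle := rowLen_anti tau (Nat.le_add_right p 1)
  rw [prod_columns_succ tau α z p fun j hj => hz _ j (by omega) hj, mul_right_comm,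
    prod_boundary tau α z hN hp fun i j hi hj => hz i j hi (hj.trans hle),
    div_mul_div_cancel₀ (hz (p + 1) _ (by omega) hle)]

end Telescoping

/-- The anisotropic coordinate of the inner end of row `i`. -/
noncomputable def nodeX (α : ℝ) {m : ℕ} (tau : m.Partition) (i : ℕ) : ℝ :=
  α * rowLen tau i - i

/-- The anisotropic coordinate of the outer corner of row `i`. -/
noncomputable def nodeY (α : ℝ) {m : ℕ} (tau : m.Partition) (i : ℕ) : ℝ :=
  α * rowLen tau i - i - 1

section Weights

variable {α : ℝ} {n m : ℕ}

lemma nodeX_strictAnti (hα : 0 < α) (tau : m.Partition) : StrictAnti (nodeX α tau) :=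
  strictAnti_nat_of_succ_lt fun k => by
    have h : (rowLen tau (k + 1) : ℝ) ≤ rowLen tau k :=
      Nat.cast_le.mpr (rowLen_anti tau (Nat.le_add_right k 1))
    have := mul_le_mul_of_nonneg_left h hα.le
    simp only [nodeX, Nat.cast_add, Nat.cast_one]
    linarith

lemma nodeX_injective (hα : 0 < α) (tau : m.Partition) : Function.Injective (nodeX α tau) :=
  (nodeX_strictAnti hα tau).injective

lemma nodeY_eq (α : ℝ) (tau : m.Partition) (k : ℕ) : nodeY α tau k = nodeX α tau k - 1 := rfl

lemma nodeY_injective (hα : 0 < α) (tau : m.Partition) : Function.Injective (nodeY α tau) :=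
  fun _ _ h => nodeX_injective hα tau (sub_left_injective h)

lemma leg_row (tau : m.Partition) {i j : ℕ} (hj : j < rowLen tau i) :
    (leg tau (i, j) : ℝ) = colLen tau j - i - 1 := by
  have h1 := (lt_rowLen_iff tau i j).mp hj
  rw [leg, Nat.cast_sub h1]
  push_cast
  ring

lemma arm_row (tau : m.Partition) {i j : ℕ} (hj : j < rowLen tau i) :
    (arm tau (i, j) : ℝ) = rowLen tau i - j - 1 := by
  rw [arm, Nat.cast_sub hj]
  push_cast
  ring

variable {tau : m.Partition} {rho : n.Partition} {i : ℕ}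

lemma AddsBox.leg_col (h : AddsBox tau rho i) {k : ℕ} (hk : k < i) :
    (leg tau (k, rowLen tau i) : ℝ) = i - k - 1 := by
  rw [leg_row tau (h.lt_rowLen_of_lt hk), h.colLen_corner]

lemma AddsBox.index_lt (h : AddsBox tau rho i) : i < n := by
  have h1 := (lt_rowLen_iff rho i (rowLen tau i)).mp (by rw [h i, if_pos rfl]; omega)
  exact h1.trans_le (colLen_le rho _)

lemma boundary_ne_zero (hα : 0 < α) (tau : m.Partition) {c : ℝ} (hc : 0 < c) {p : ℕ} (i j : ℕ)
    (hi : p < i) (hj : j ≤ rowLen tau p) :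
    α * rowLen tau p - (p + 1 : ℕ) + c - α * j + i ≠ 0 := by
  have h1 : ((p + 1 : ℕ) : ℝ) ≤ i := Nat.cast_le.mpr hi
  have h2 : (j : ℝ) ≤ rowLen tau p := Nat.cast_le.mpr hj
  have := mul_le_mul_of_nonneg_left h2 hα.le
  exact (by linarith : (0 : ℝ) < _).ne'

/-- The transition probabilities of the up chain. -/
lemma AddsBox.up_eq (h : AddsBox tau rho i) (hnm : n = m + 1) (hα : 0 < α) :
    psiGen α rho tau * cLow α tau / cLow α rho =
      nodeWeight (nodeX α tau) (nodeY α tau) m i := by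
  have hin : i < m + 1 := hnm ▸ h.index_lt
  rw [h.up_eq_prod hα, nodeWeight]
  have hb := prod_boundary_succ tau α (nodeX α tau i) (Nat.le_add_right m 1) hin
    fun k j hk hj => by
      have := boundary_ne_zero hα tau one_pos k j hk hj
      rw [nodeX]
      push_cast at this ⊢
      convert this using 1
      ring
  have hrow : ∏ j ∈ range (rowLen tau i), (α * arm tau (i, j) + leg tau (i, j) + 1) /
      (α * (arm tau (i, j) + 1 : ℕ) + leg tau (i, j) + 1) =
      (∏ j ∈ range (rowLen tau i), (nodeX α tau i - α * j + colLen tau j) /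
        (nodeX α tau i - α * (j + 1 : ℕ) + colLen tau j))⁻¹ := by
    rw [← prod_inv_distrib]
    refine prod_congr rfl fun j hj => ?_
    rw [mem_range] at hj
    rw [inv_div, Nat.cast_add, arm_row tau hj, leg_row tau hj, nodeX]
    push_cast
    congr 1 <;> ring
  have hcol : ∏ k ∈ range i, (α * arm tau (k, rowLen tau i) + leg tau (k, rowLen tau i) + α) /
      (α * arm tau (k, rowLen tau i) + (leg tau (k, rowLen tau i) + 1 : ℕ) + α) =
      ∏ k ∈ range i, (nodeX α tau i - nodeY α tau k) / (nodeX α tau i - nodeX α tau k) := by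
    refine prod_congr rfl fun k hk => ?_
    rw [mem_range] at hk
    rw [Nat.cast_add, arm_row tau (h.lt_rowLen_of_lt hk), h.leg_col hk, ← neg_div_neg_eq,
      nodeX, nodeY, nodeX]
    push_cast
    congr 1 <;> ring
  have hbot : ∏ k ∈ Ico (i + 1) (m + 1),
      (nodeX α tau i - α * rowLen tau k + (k + 1 : ℕ)) / (nodeX α tau i - α * rowLen tau k + k) =
      ∏ k ∈ Ico (i + 1) (m + 1),
        (nodeX α tau i - nodeY α tau k) / (nodeX α tau i - nodeX α tau k) := by
    refine prod_congr rfl fun k _ => ?_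
    rw [nodeX, nodeY, nodeX]
    push_cast
    congr 1 <;> ring
  have hone : nodeX α tau i - α * rowLen tau i + (i + 1 : ℕ) = 1 := by
    rw [nodeX]
    push_cast
    ring
  have hlast : nodeX α tau i - nodeY α tau m = nodeX α tau i + (m + 1 : ℕ) := by
    rw [nodeY, rowLen_eq_zero tau le_rfl]
    push_cast
    ring
  have hlast0 : nodeX α tau i + (m + 1 : ℕ) ≠ 0 := by
    rw [nodeX]
    have h1 : (i : ℝ) < (m + 1 : ℕ) := Nat.cast_lt.mpr hin
    have h2 : 0 ≤ α * rowLen tau i := by positivity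
    exact (by linarith : (0 : ℝ) < _).ne'
  have hnum : (∏ k ∈ range m, (nodeX α tau i - nodeY α tau k)) =
      (∏ k ∈ (range (m + 1)).erase i, (nodeX α tau i - nodeY α tau k)) /
        (nodeX α tau i + (m + 1 : ℕ)) := by
    rw [eq_div_iff hlast0, ← hlast, ← prod_range_succ,
      ← mul_prod_erase _ _ (mem_range.mpr hin), nodeY_eq, sub_sub_cancel, one_mul]
  rw [hrow, hcol, hnum, div_right_comm, ← prod_div_distrib, prod_erase_range _ hin]
  rw [hbot, hone, div_one] at hb
  rw [eq_div_iff hlast0, ← hb]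
  have hP := left_ne_zero_of_mul (hb ▸ hlast0)
  field_simp

/-- The residue of the co-transition function at the corner of row `i`. -/
noncomputable def downWeight (α : ℝ) (lam : n.Partition) (i : ℕ) : ℝ :=
  (nodeY α lam i + n) *
    ∏ k ∈ (range n).erase i, (nodeY α lam i - nodeX α lam k) / (nodeY α lam i - nodeY α lam k)

/-- The transition probabilities of the down chain, up to a constant factor. -/
lemma AddsBox.down_eq (h : AddsBox tau rho i) (hnm : n = m + 1) (hα : 0 < α) :
    cUp α rho * psiGen α rho tau / cUp α tau = downWeight α rho i := by
  have hin : i < n := h.index_lt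
  have hi : (rowLen rho i : ℝ) = rowLen tau i + 1 := by rw [h i, if_pos rfl]; push_cast; ring
  have hne : ∀ k, k ≠ i → rowLen rho k = rowLen tau k := fun k hk => by rw [h k, if_neg hk]; rfl
  rw [h.down_eq_prod hα, downWeight, prod_erase_range _ hin]
  have hb := prod_boundary_succ tau α (nodeY α rho i) (by omega : m ≤ n) hin
    fun k j hk hj => by
      have := boundary_ne_zero hα tau hα k j hk hj
      rw [nodeY, hi]
      push_cast at this ⊢
      convert this using 1
      ring
  have hrow : ∏ j ∈ range (rowLen tau i), (α * (arm tau (i, j) + 1 : ℕ) + leg tau (i, j) + α) /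
        (α * arm tau (i, j) + leg tau (i, j) + α) =
      ∏ j ∈ range (rowLen tau i), (nodeY α rho i - α * j + colLen tau j) /
        (nodeY α rho i - α * (j + 1 : ℕ) + colLen tau j) := by
    refine prod_congr rfl fun j hj => ?_
    rw [mem_range] at hj
    rw [Nat.cast_add, arm_row tau hj, leg_row tau hj, nodeY, hi]
    push_cast
    congr 1 <;> ring
  have hcol : ∏ k ∈ range i,
        (α * arm tau (k, rowLen tau i) + (leg tau (k, rowLen tau i) + 1 : ℕ) + 1) /
        (α * arm tau (k, rowLen tau i) + leg tau (k, rowLen tau i) + 1) =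
      ∏ k ∈ range i, (nodeY α rho i - nodeX α rho k) / (nodeY α rho i - nodeY α rho k) := by
    refine prod_congr rfl fun k hk => ?_
    rw [mem_range] at hk
    rw [Nat.cast_add, arm_row tau (h.lt_rowLen_of_lt hk), h.leg_col hk, ← neg_div_neg_eq,
      nodeX, nodeY, nodeY, hi, hne k hk.ne]
    push_cast
    congr 1 <;> ring
  have hbot : ∏ k ∈ Ico (i + 1) n,
      (nodeY α rho i - α * rowLen tau k + (k + 1 : ℕ)) / (nodeY α rho i - α * rowLen tau k + k) =
      (∏ k ∈ Ico (i + 1) n,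
        (nodeY α rho i - nodeX α rho k) / (nodeY α rho i - nodeY α rho k))⁻¹ := by
    rw [← prod_inv_distrib]
    refine prod_congr rfl fun k hk => ?_
    rw [mem_Ico] at hk
    rw [inv_div, nodeX, nodeY, nodeY, hne k (by omega)]
    push_cast
    congr 1 <;> ring
  have hcorner : nodeY α rho i - α * rowLen tau i + (i + 1 : ℕ) = α := by
    rw [nodeY, hi]
    push_cast
    ring
  have hprod : ∏ k ∈ Ico (i + 1) n,
      (nodeY α rho i - nodeX α rho k) / (nodeY α rho i - nodeY α rho k) ≠ 0 := by
    refine prod_ne_zero_iff.mpr fun k hk => div_ne_zero ?_ ?_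
    · rw [mem_Ico] at hk
      have := boundary_ne_zero hα tau hα k (rowLen tau k) hk.1 (rowLen_anti tau (by omega))
      rw [nodeY, nodeX, hi, hne k (by omega)]
      push_cast at this ⊢
      convert this using 1
      ring
    · rw [mem_Ico] at hk
      exact sub_ne_zero.mpr ((nodeY_injective hα rho).ne (by omega))
  rw [hbot, hcorner, ← div_eq_mul_inv, div_eq_iff hprod] at hb
  rw [hrow, hcol, hb]
  field_simp

end Weights

lemma sum_eq_sum_of_rel {ι κ : Type*} {s : Finset ι} {t : Finset κ} (R : ι → κ → Prop)
    {f : ι → ℝ} {g : κ → ℝ} (hval : ∀ a b, R a b → f a = g b)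
    (hf : ∀ a ∈ s, f a ≠ 0 → ∃ b ∈ t, R a b) (hg : ∀ b ∈ t, g b ≠ 0 → ∃ a ∈ s, R a b)
    (hl : ∀ a a' b, R a b → R a' b → a = a') (hr : ∀ a b b', R a b → R a b' → b = b') :
    ∑ a ∈ s, f a = ∑ b ∈ t, g b := by
  choose φ hφ hR using hf
  refine sum_bij_ne_zero φ hφ ?_ ?_ ?_
  · intro a ha hfa a' ha' hfa' heq
    exact hl a a' _ (hR a ha hfa) (heq ▸ hR a' ha' hfa')
  · intro b hb hgb
    obtain ⟨a, ha, hab⟩ := hg b hb hgb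
    have hfa : f a ≠ 0 := by rwa [hval a b hab]
    exact ⟨a, ha, hfa, hr a _ _ (hR a ha hfa) hab⟩
  · intro a ha hfa
    exact hval a _ (hR a ha hfa)

/-- The sum of the contents of the boxes of a diagram. -/
noncomputable def contentSum (α : ℝ) {n : ℕ} (lam : n.Partition) : ℝ :=
  ∑ s ∈ cells lam, (α * s.2 - s.1)

/-- The sum of the squares of the contents of the boxes of a diagram. -/
noncomputable def contentSqSum (α : ℝ) {n : ℕ} (lam : n.Partition) : ℝ :=
  ∑ s ∈ cells lam, (α * s.2 - s.1) ^ 2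

/-- The one-step probabilities of the up chain. -/
noncomputable def upProb (α : ℝ) {n m : ℕ} (tau : m.Partition) (rho : n.Partition) : ℝ :=
  psiGen α rho tau * cLow α tau / cLow α rho

/-- The one-step probabilities of the down chain. -/
noncomputable def downProb (α : ℝ) {n m : ℕ} (lam : n.Partition) (tau : m.Partition) : ℝ :=
  cUp α lam * psiGen α lam tau / cUp α tau / (α * n)

section Chains

variable {α : ℝ} {n m : ℕ}

lemma sub_eq_contentSum (α : ℝ) (lam : n.Partition) :
    α * nStatConj lam - nStat lam = contentSum α lam := by
  rw [contentSum, sum_sub_distrib, sum_cells lam fun s => (s.1 : ℝ),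
    sum_cells' lam fun s => α * (s.2 : ℝ), nStatConj, nStat]
  simp only [sum_const, card_range, nsmul_eq_mul]
  push_cast
  rw [mul_sum]
  congr 1
  · exact sum_congr rfl fun _ _ => by ring
  · exact sum_congr rfl fun _ _ => by ring

lemma AddsBox.contentSum_eq {tau : m.Partition} {rho : n.Partition} {i : ℕ}
    (h : AddsBox tau rho i) : contentSum α rho = contentSum α tau + nodeX α tau i := by
  rw [contentSum, contentSum, h.cells_eq, sum_insert (corner_notMem tau i), nodeX, add_comm]

lemma AddsBox.contentSqSum_eq {tau : m.Partition} {rho : n.Partition} {i : ℕ}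
    (h : AddsBox tau rho i) :
    contentSqSum α rho = contentSqSum α tau + nodeX α tau i ^ 2 := by
  rw [contentSqSum, contentSqSum, h.cells_eq, sum_insert (corner_notMem tau i), nodeX, add_comm]

lemma AddsBox.nodeX_eq {tau : m.Partition} {rho : n.Partition} {i : ℕ}
    (h : AddsBox tau rho i) : nodeX α tau i = nodeY α rho i - α + 1 := by
  rw [nodeX, nodeY, h i, if_pos rfl]
  push_cast
  ring

lemma psiGen_ne_zero_subset {lam : n.Partition} {tau : m.Partition}
    (h : psiGen α lam tau ≠ 0) : cells tau ⊆ cells lam := by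
  by_contra hs
  exact h (by rw [psiGen, if_neg hs])

lemma sum_upProb (hα : 0 < α) (hnm : n = m + 1) (tau : m.Partition) (f : n.Partition → ℝ)
    (g : ℕ → ℝ) (hfg : ∀ rho i, AddsBox tau rho i → f rho = g i) :
    ∑ rho, upProb α tau rho * f rho =
      ∑ i ∈ range (m + 1), nodeWeight (nodeX α tau) (nodeY α tau) m i * g i := by
  refine sum_eq_sum_of_rel (AddsBox tau) ?_ ?_ ?_ (fun _ _ _ => AddsBox.upper_unique)
    (fun _ _ _ => AddsBox.index_unique)
  · intro rho i h
    rw [upProb, h.up_eq hnm hα, hfg rho i h]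
  · intro rho _ hne
    have hsub : cells tau ⊆ cells rho :=
      psiGen_ne_zero_subset (α := α) fun h0 => hne (by simp [upProb, h0])
    obtain ⟨i, hi, h⟩ := exists_addsBox_of_subset hnm hsub
    exact ⟨i, mem_range.mpr (hnm ▸ hi), h⟩
  · intro i hi hne
    rw [mem_range] at hi
    obtain ⟨rho, h⟩ := exists_addsBox_upper hnm tau (i := i) (by omega) fun k hk => by
      by_contra hle
      have heq : rowLen tau k = rowLen tau i :=
        le_antisymm (not_lt.mp hle) (rowLen_anti tau (by omega))
      apply hne
      rw [nodeWeight, prod_eq_zero (i := k) (mem_range.mpr (by omega)), zero_div, zero_mul]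
      rw [nodeX, nodeY, heq, hk]
      push_cast
      ring
    exact ⟨rho, mem_univ _, h⟩

lemma sum_downProb (hα : 0 < α) (hnm : n = m + 1) (lam : n.Partition) (f : m.Partition → ℝ)
    (g : ℕ → ℝ) (hfg : ∀ tau i, AddsBox tau lam i → f tau = g i) :
    ∑ tau, downProb α lam tau * f tau =
      ∑ i ∈ range n, downWeight α lam i / (α * n) * g i := by
  refine sum_eq_sum_of_rel (fun tau i => AddsBox tau lam i) ?_ ?_ ?_
    (fun _ _ _ => AddsBox.lower_unique) (fun _ _ _ => AddsBox.index_unique)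
  · intro tau i h
    rw [downProb, h.down_eq hnm hα, hfg tau i h]
  · intro tau _ hne
    have hsub : cells tau ⊆ cells lam :=
      psiGen_ne_zero_subset (α := α) fun h0 => hne (by simp [downProb, h0])
    obtain ⟨i, hi, h⟩ := exists_addsBox_of_subset hnm hsub
    exact ⟨i, mem_range.mpr hi, h⟩
  · intro i hi hne
    rw [mem_range] at hi
    obtain ⟨tau, h⟩ := exists_addsBox_lower hnm lam hi (by
      by_contra hle
      have heq : rowLen lam (i + 1) = rowLen lam i :=
        le_antisymm (rowLen_anti lam (by omega)) (not_lt.mp hle)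
      apply hne
      rw [downWeight]
      rcases (Nat.succ_le_of_lt hi).eq_or_lt with hlast | hlt
      · have h0 : nodeY α lam i + n = 0 := by
          rw [nodeY, ← heq, rowLen_eq_zero lam hlast.ge, ← hlast]
          push_cast
          ring
        rw [h0]
        ring
      · rw [prod_eq_zero (i := i + 1) (mem_erase.mpr ⟨by omega, mem_range.mpr hlt⟩)]
        · ring
        · rw [nodeX, nodeY, heq]
          push_cast
          ring)
    exact ⟨tau, mem_univ _, h⟩

lemma superPowerSum_eq_sum_cells (α : ℝ) (tau : m.Partition) {k : ℕ} (hk : k ≠ 0) :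
    superPowerSum (nodeX α tau) (nodeY α tau) k m =
      ∑ s ∈ cells tau, ((α * s.2 - s.1 + α) ^ k - (α * s.2 - s.1 + α - 1) ^ k -
        (α * s.2 - s.1) ^ k + (α * s.2 - s.1 - 1) ^ k) := by
  rw [sum_cells]
  have hrow : ∀ i ∈ range m, ∑ j ∈ range (rowLen tau i),
      ((α * j - i + α) ^ k - (α * j - i + α - 1) ^ k - (α * j - i) ^ k + (α * j - i - 1) ^ k) =
      (nodeX α tau i ^ k - nodeY α tau i ^ k) +
        ((-((i + 1 : ℕ) : ℝ)) ^ k - (-(i : ℝ)) ^ k) := by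
    intro i _
    have h := sum_range_sub (fun j : ℕ => (α * j - i) ^ k - (α * j - i - 1) ^ k) (rowLen tau i)
    have h2 : ∑ j ∈ range (rowLen tau i), ((α * j - i + α) ^ k - (α * j - i + α - 1) ^ k -
        (α * j - i) ^ k + (α * j - i - 1) ^ k) =
        ∑ j ∈ range (rowLen tau i), (((α * (j + 1 : ℕ) - i) ^ k - (α * (j + 1 : ℕ) - i - 1) ^ k) -
        ((α * j - i) ^ k - (α * j - i - 1) ^ k)) := by
      refine sum_congr rfl fun j _ => ?_
      rw [show α * (j + 1 : ℕ) - i = α * j - i + α by push_cast; ring]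
      ring
    rw [h2, h, nodeX, nodeY, show α * (0 : ℕ) - (i : ℝ) - 1 = -((i + 1 : ℕ) : ℝ) by push_cast; ring,
      show α * (0 : ℕ) - (i : ℝ) = -(i : ℝ) by push_cast; ring]
    ring
  rw [sum_congr rfl hrow, sum_add_distrib, sum_range_sub fun i : ℕ => (-(i : ℝ)) ^ k,
    superPowerSum, sum_range_succ, sum_sub_distrib, nodeX, rowLen_eq_zero tau le_rfl]
  simp only [Nat.cast_zero, mul_zero, zero_sub, neg_zero, zero_pow hk, sub_zero]
  ring

lemma superPowerSum_values (α : ℝ) (tau : m.Partition) :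
    superPowerSum (nodeX α tau) (nodeY α tau) 1 m = 0 ∧
    superPowerSum (nodeX α tau) (nodeY α tau) 2 m = 2 * α * m ∧
    superPowerSum (nodeX α tau) (nodeY α tau) 3 m =
      6 * α * contentSum α tau + 3 * α * (α - 1) * m ∧
    superPowerSum (nodeX α tau) (nodeY α tau) 4 m =
      12 * α * contentSqSum α tau + 12 * α * (α - 1) * contentSum α tau +
        (4 * α ^ 3 - 6 * α ^ 2 + 4 * α) * m := by
  have hm : (m : ℝ) = ∑ s ∈ cells tau, 1 := by simp [card_cells]
  rw [superPowerSum_eq_sum_cells α tau one_ne_zero, superPowerSum_eq_sum_cells α tau two_ne_zero,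
    superPowerSum_eq_sum_cells α tau three_ne_zero, superPowerSum_eq_sum_cells α tau four_ne_zero,
    hm, contentSum, contentSqSum]
  simp only [mul_sum, ← sum_add_distrib]
  refine ⟨sum_eq_zero fun s _ => by ring, ?_, ?_, ?_⟩ <;>
    exact sum_congr rfl fun s _ => by ring

/-- The first four moments of the up chain. -/
lemma up_moments (hα : 0 < α) (tau : m.Partition) :
    moment (nodeX α tau) (nodeY α tau) 1 m = 0 ∧
    moment (nodeX α tau) (nodeY α tau) 2 m = α * m ∧
    moment (nodeX α tau) (nodeY α tau) 3 m = 2 * α * contentSum α tau + α * (α - 1) * m ∧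
    moment (nodeX α tau) (nodeY α tau) 4 m =
      3 * α * contentSqSum α tau + 3 * α * (α - 1) * contentSum α tau +
        (α ^ 3 - 3 / 2 * α ^ 2 + α) * m + α ^ 2 * m ^ 2 / 2 := by
  obtain ⟨h1, h2, h3, h4⟩ := moment_eq (nodeX_injective hα tau) (nodeY α tau) m
  obtain ⟨p1, p2, p3, p4⟩ := superPowerSum_values α tau
  rw [h1, h2, h3, h4, p1, p2, p3, p4]
  refine ⟨rfl, ?_, ?_, ?_⟩ <;> ring

lemma downWeight_eq (hnm : n = m + 1) (lam : n.Partition) {i : ℕ} (hi : i < n) :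
    downWeight α lam i = -(nodeY α lam i + n) * (nodeY α lam i - nodeX α lam 0) *
      nodeWeight (nodeY α lam) (fun k => nodeX α lam (k + 1)) m i := by
  subst hnm
  have h1 : ∏ k ∈ range (m + 1), (nodeY α lam i - nodeX α lam k) =
      -∏ k ∈ (range (m + 1)).erase i, (nodeY α lam i - nodeX α lam k) := by
    rw [← mul_prod_erase _ _ (mem_range.mpr hi), nodeY_eq]
    ring
  rw [prod_range_succ'] at h1
  rw [downWeight, nodeWeight, prod_div_distrib, ← neg_neg (∏ k ∈ _, (_ - nodeX α lam k)), ← h1]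
  ring

lemma superPowerSum_dual (x y : ℕ → ℝ) (k : ℕ) :
    superPowerSum y (fun i => x (i + 1)) k m =
      x 0 ^ k + x (m + 1) ^ k - superPowerSum x y k (m + 1) := by
  rw [superPowerSum, superPowerSum, sum_range_succ' _ (m + 1),
    sum_range_succ (fun i => x (i + 1) ^ k)]
  ring

/-- The moments of order at most two of the down chain. -/
lemma down_moments (hα : 0 < α) (hnm : n = m + 1) (lam : n.Partition) :
    ∑ i ∈ range n, downWeight α lam i = α * n ∧
    ∑ i ∈ range n, downWeight α lam i * nodeY α lam i =
      2 * α * contentSum α lam + α * (α - 1) * n ∧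
    ∑ i ∈ range n, downWeight α lam i * nodeY α lam i ^ 2 =
      3 * α * contentSqSum α lam + 3 * α * (α - 1) * contentSum α lam +
        (α ^ 3 - 3 / 2 * α ^ 2 + α) * n - α ^ 2 * n ^ 2 / 2 := by
  have hk : ∀ k, ∑ i ∈ range n, downWeight α lam i * nodeY α lam i ^ k =
      -(moment (nodeY α lam) (fun i => nodeX α lam (i + 1)) (k + 2) m +
        (n - nodeX α lam 0) * moment (nodeY α lam) (fun i => nodeX α lam (i + 1)) (k + 1) m -
        n * nodeX α lam 0 * moment (nodeY α lam) (fun i => nodeX α lam (i + 1)) k m) := by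
    intro k
    simp only [moment, mul_sum, ← sum_add_distrib, ← sum_sub_distrib, ← sum_neg_distrib, ← hnm]
    refine sum_congr rfl fun i hi => ?_
    rw [downWeight_eq hnm lam (mem_range.mp hi)]
    ring
  subst hnm
  have hXn : nodeX α lam (m + 1) = -((m + 1 : ℕ) : ℝ) := by
    rw [nodeX, rowLen_eq_zero lam le_rfl]
    ring
  obtain ⟨h1, h2, h3, h4⟩ :=
    moment_eq (nodeY_injective hα lam) (fun i => nodeX α lam (i + 1)) m
  have h0 := moment_zero (nodeY_injective hα lam) (fun i => nodeX α lam (i + 1)) m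
  obtain ⟨p1, p2, p3, p4⟩ := superPowerSum_values α lam
  simp only [superPowerSum_dual, hXn, p1, p2, p3, p4] at h1 h2 h3 h4
  have k0 := hk 0
  have k1 := hk 1
  have k2 := hk 2
  norm_num only [pow_zero, mul_one, pow_one, zero_add] at k0 k1 k2
  rw [k0, k1, k2, h0, h1, h2, h3, h4]
  refine ⟨?_, ?_, ?_⟩ <;> ring

end Chains

section Expectations

variable {α : ℝ} {m : ℕ}

/-- The mean over an up step of a statistic that is a polynomial in the content of the added box. -/
lemma sum_upProb_poly (hα : 0 < α) (tau : m.Partition) (f : (m + 1).Partition → ℝ)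
    (c0 c1 c2 c3 c4 : ℝ)
    (hf : ∀ rho i, AddsBox tau rho i → f rho = c0 + c1 * nodeX α tau i + c2 * nodeX α tau i ^ 2 +
      c3 * nodeX α tau i ^ 3 + c4 * nodeX α tau i ^ 4) :
    ∑ rho, upProb α tau rho * f rho = c0 + c2 * (α * m) +
      c3 * (2 * α * contentSum α tau + α * (α - 1) * m) +
      c4 * (3 * α * contentSqSum α tau + 3 * α * (α - 1) * contentSum α tau +
        (α ^ 3 - 3 / 2 * α ^ 2 + α) * m + α ^ 2 * m ^ 2 / 2) := by
  obtain ⟨h1, h2, h3, h4⟩ := up_moments hα tau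
  have h0 := moment_zero (nodeX_injective hα tau) (nodeY α tau) m
  rw [sum_upProb hα rfl tau f _ hf, ← h4, ← h3, ← h2]
  have h : c0 + c2 * moment (nodeX α tau) (nodeY α tau) 2 m +
      c3 * moment (nodeX α tau) (nodeY α tau) 3 m + c4 * moment (nodeX α tau) (nodeY α tau) 4 m =
      c0 * moment (nodeX α tau) (nodeY α tau) 0 m + c1 * moment (nodeX α tau) (nodeY α tau) 1 m +
      c2 * moment (nodeX α tau) (nodeY α tau) 2 m +
      c3 * moment (nodeX α tau) (nodeY α tau) 3 m +
      c4 * moment (nodeX α tau) (nodeY α tau) 4 m := by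
    rw [h0, h1]
    ring
  rw [h]
  simp only [moment, mul_sum, ← sum_add_distrib]
  exact sum_congr rfl fun i _ => by ring

lemma sum_downProb_one (hα : 0 < α) (lam : (m + 1).Partition) :
    ∑ tau : m.Partition, downProb α lam tau = 1 := by
  have h := sum_downProb hα rfl lam (fun _ : m.Partition => 1) (fun _ => 1) fun _ _ _ => rfl
  simp only [mul_one, ← sum_div, (down_moments hα rfl lam).1] at h
  rw [h]
  exact div_self (by positivity)

/-- The second moment of the content of the box removed by the down chain. -/
lemma sum_downProb_sq (hα : 0 < α) (lam : (m + 1).Partition) :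
    ∑ tau : m.Partition, downProb α lam tau * (contentSum α lam - contentSum α tau) ^ 2 =
      (3 * contentSqSum α lam - (α - 1) * contentSum α lam) / (m + 1) - α * m / 2 := by
  obtain ⟨h0, h1, h2⟩ := down_moments hα rfl lam
  rw [sum_downProb hα rfl lam _ (fun i => (nodeY α lam i - α + 1) ^ 2) fun tau i h => by
    rw [h.contentSum_eq, add_sub_cancel_left, h.nodeX_eq]]
  have h : ∑ i ∈ range (m + 1), downWeight α lam i / (α * (m + 1 : ℕ)) *
      (nodeY α lam i - α + 1) ^ 2 =
      (∑ i ∈ range (m + 1), downWeight α lam i * nodeY α lam i ^ 2 -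
        2 * (α - 1) * ∑ i ∈ range (m + 1), downWeight α lam i * nodeY α lam i +
        (α - 1) ^ 2 * ∑ i ∈ range (m + 1), downWeight α lam i) / (α * (m + 1 : ℕ)) := by
    simp only [mul_sum, ← sum_add_distrib, ← sum_sub_distrib, sum_div]
    exact sum_congr rfl fun i _ => by ring
  rw [h, h0, h1, h2]
  push_cast
  field_simp
  ring

/-- The chain `M α` is a down step followed by an up step. -/
lemma M_eq_sum (α : ℝ) (lam rho : (m + 1).Partition) :
    M α lam rho = ∑ tau : m.Partition, downProb α lam tau * upProb α tau rho := by
  rw [M, mul_sum]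
  refine sum_congr rfl fun tau _ => ?_
  change _ * (psiGen α lam tau * psiGen α rho tau * cLow α tau / cUp α tau) = _
  rw [downProb, upProb]
  simp only [div_eq_mul_inv, mul_inv]
  ring

lemma sum_M_sq (hα : 0 < α) (lam : (m + 1).Partition) :
    ∑ rho, M α lam rho * (contentSum α rho - contentSum α lam) ^ 2 =
      (3 * contentSqSum α lam - (α - 1) * contentSum α lam) / (m + 1) + α * m / 2 := by
  simp only [M_eq_sum, sum_mul]
  rw [sum_comm]
  have h : ∀ tau : m.Partition, ∑ rho : (m + 1).Partition, downProb α lam tau * upProb α tau rho *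
      (contentSum α rho - contentSum α lam) ^ 2 =
      downProb α lam tau * (α * m) +
        downProb α lam tau * (contentSum α lam - contentSum α tau) ^ 2 := by
    intro tau
    simp only [mul_assoc]
    rw [← mul_sum, sum_upProb_poly hα tau _ ((contentSum α lam - contentSum α tau) ^ 2)
      (-2 * (contentSum α lam - contentSum α tau)) 1 0 0 fun rho i h => by
        rw [h.contentSum_eq]; ring]
    ring
  rw [sum_congr rfl fun tau _ => h tau, sum_add_distrib, ← sum_mul, sum_downProb_one hα,
    sum_downProb_sq hα]
  ring

lemma stein_term_eq (hα : 0 < α) (hm : 1 ≤ m) (lam : (m + 1).Partition) :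
    -1 + ((m + 1 : ℕ) : ℝ) / 4 * ∑ rho, M α lam rho * (W α rho - W α lam) ^ 2 =
      (3 * contentSqSum α lam - (α - 1) * contentSum α lam - 3 / 2 * α * m * (m + 1)) /
        (2 * α * m * (m + 1)) := by
  have hm0 : (m : ℝ) ≠ 0 := by positivity
  have hC : (((m + 1).choose 2 : ℕ) : ℝ) = m * (m + 1) / 2 := by
    rw [Nat.cast_choose_two]
    push_cast
    ring
  have hW : ∀ rho : (m + 1).Partition, M α lam rho * (W α rho - W α lam) ^ 2 =
      M α lam rho * (contentSum α rho - contentSum α lam) ^ 2 / (α * (m * (m + 1) / 2)) := by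
    intro rho
    rw [W, W, sub_eq_contentSum, sub_eq_contentSum, ← sub_div, div_pow, hC,
      Real.sq_sqrt (by positivity), ← mul_div_assoc]
  rw [sum_congr rfl fun rho _ => hW rho, ← sum_div, sum_M_sq hα]
  push_cast
  field_simp
  ring

/-- Detailed balance between the up and down chains. -/
lemma jackP_mul_downProb (hα : 0 < α) (rho : (m + 1).Partition) (tau : m.Partition) :
    jackP α rho * downProb α rho tau = jackP α tau * upProb α tau rho := by
  have h1 := (cLow_pos hα rho).ne'
  have h2 := (cUp_pos hα rho).ne'
  have h3 := (cLow_pos hα tau).ne'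
  have h4 := (cUp_pos hα tau).ne'
  rw [jackP, jackP, downProb, upProb, Nat.factorial_succ]
  push_cast
  field_simp
  ring

/-- The Jack measure is propagated by the up chain. -/
lemma sum_jackP_succ (hα : 0 < α) (f : (m + 1).Partition → ℝ) :
    ∑ rho, jackP α rho * f rho =
      ∑ tau : m.Partition, jackP α tau * ∑ rho, upProb α tau rho * f rho := by
  have h : ∀ rho : (m + 1).Partition, jackP α rho * f rho =
      ∑ tau : m.Partition, jackP α tau * (upProb α tau rho * f rho) := by
    intro rho
    simp only [← mul_assoc, ← jackP_mul_downProb hα]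
    rw [← sum_mul, ← mul_sum, sum_downProb_one hα, mul_one]
  rw [sum_congr rfl fun rho _ => h rho, sum_comm]
  simp only [mul_sum]

lemma sum_jackP_poly (α : ℝ) (n : ℕ) (c c1 c2 c11 c12 c22 : ℝ) :
    ∑ lam : n.Partition, jackP α lam *
      (c + c1 * contentSum α lam + c2 * contentSqSum α lam + c11 * contentSum α lam ^ 2 +
        c12 * (contentSum α lam * contentSqSum α lam) + c22 * contentSqSum α lam ^ 2) =
    c * ∑ lam : n.Partition, jackP α lam +
      c1 * ∑ lam : n.Partition, jackP α lam * contentSum α lam +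
      c2 * ∑ lam : n.Partition, jackP α lam * contentSqSum α lam +
      c11 * ∑ lam : n.Partition, jackP α lam * contentSum α lam ^ 2 +
      c12 * ∑ lam : n.Partition, jackP α lam * (contentSum α lam * contentSqSum α lam) +
      c22 * ∑ lam : n.Partition, jackP α lam * contentSqSum α lam ^ 2 := by
  simp only [mul_sum, ← sum_add_distrib]
  exact sum_congr rfl fun lam _ => by ring

/-- The joint moments of the two content sums under the Jack measure. -/
lemma jack_moments (hα : 0 < α) (n : ℕ) :
    ∑ lam : n.Partition, jackP α lam = 1 ∧
    ∑ lam : n.Partition, jackP α lam * contentSum α lam = 0 ∧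
    ∑ lam : n.Partition, jackP α lam * contentSqSum α lam = α * (n * (n - 1) / 2) ∧
    ∑ lam : n.Partition, jackP α lam * contentSum α lam ^ 2 = α * (n * (n - 1) / 2) ∧
    ∑ lam : n.Partition, jackP α lam * (contentSum α lam * contentSqSum α lam) =
      α * (α - 1) * (n * (n - 1) / 2) ∧
    ∑ lam : n.Partition, jackP α lam * contentSqSum α lam ^ 2 =
      α ^ 2 * (n * (n - 1) * (n - 2) * (n - 3)) / 4 + 4 / 3 * α ^ 2 * (n * (n - 1) * (n - 2)) +
        (α ^ 3 - α ^ 2 + α) * (n * (n - 1) / 2) := by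
  induction n with
  | zero =>
    have hc : ∀ lam : (0 : ℕ).Partition, cells lam = ∅ := fun lam => by simp [cells]
    simp [jackP, contentSum, contentSqSum, cLow, cUp, hc]
  | succ m ih =>
    obtain ⟨e, e1, e2, e11, e12, e22⟩ := ih
    have key := sum_jackP_poly α m
    rw [e, e1, e2, e11, e12, e22] at key
    have step := fun (f : (m + 1).Partition → ℝ) (c c1 c2 c11 c12 c22 : ℝ)
        (h : ∀ tau : m.Partition, ∑ rho, upProb α tau rho * f rho =
          c + c1 * contentSum α tau + c2 * contentSqSum α tau + c11 * contentSum α tau ^ 2 +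
          c12 * (contentSum α tau * contentSqSum α tau) + c22 * contentSqSum α tau ^ 2) =>
      (sum_jackP_succ hα f).trans ((sum_congr rfl fun tau _ =>
        congrArg (jackP α tau * ·) (h tau)).trans (key c c1 c2 c11 c12 c22))
    refine ⟨?_, ?_, ?_, ?_, ?_, ?_⟩
    · have h := step (fun _ => 1) 1 0 0 0 0 0 fun tau => by
        rw [sum_upProb_poly hα tau _ 1 0 0 0 0 fun rho i h => by ring]
        ring
      simp only [mul_one] at h
      rw [h]
      ring
    · rw [step _ 0 1 0 0 0 0 fun tau => by
        rw [sum_upProb_poly hα tau _ (contentSum α tau) 1 0 0 0 fun rho i h => by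
          rw [h.contentSum_eq]; ring]
        ring]
      ring
    · rw [step _ (α * m) 0 1 0 0 0 fun tau => by
        rw [sum_upProb_poly hα tau _ (contentSqSum α tau) 0 1 0 0 fun rho i h => by
          rw [h.contentSqSum_eq]; ring]
        ring]
      push_cast
      ring
    · rw [step _ (α * m) 0 0 1 0 0 fun tau => by
        rw [sum_upProb_poly hα tau _ (contentSum α tau ^ 2) (2 * contentSum α tau) 1 0 0
          fun rho i h => by rw [h.contentSum_eq]; ring]
        ring]
      push_cast
      ring
    · rw [step _ (α * (α - 1) * m) (α * m + 2 * α) 0 0 1 0 fun tau => by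
        rw [sum_upProb_poly hα tau _ (contentSum α tau * contentSqSum α tau) (contentSqSum α tau)
          (contentSum α tau) 1 0 fun rho i h => by rw [h.contentSum_eq, h.contentSqSum_eq]; ring]
        ring]
      push_cast
      ring
    · rw [step _ ((α ^ 3 - 3 / 2 * α ^ 2 + α) * m + α ^ 2 * m ^ 2 / 2) (3 * α * (α - 1))
        (2 * α * m + 3 * α) 0 0 1 fun tau => by
        rw [sum_upProb_poly hα tau _ (contentSqSum α tau ^ 2) 0 (2 * contentSqSum α tau) 0 1
          fun rho i h => by rw [h.contentSqSum_eq]; ring]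
        ring]
      push_cast
      ring

lemma sum_jackP_sq_sub (hα : 0 < α) (n : ℕ) (c d : ℝ) :
    ∑ lam : n.Partition, jackP α lam *
      (3 * contentSqSum α lam - c * contentSum α lam - d) ^ 2 =
    9 * (α ^ 2 * (n * (n - 1) * (n - 2) * (n - 3)) / 4 +
      4 / 3 * α ^ 2 * (n * (n - 1) * (n - 2)) + (α ^ 3 - α ^ 2 + α) * (n * (n - 1) / 2)) -
    6 * c * (α * (α - 1) * (n * (n - 1) / 2)) + c ^ 2 * (α * (n * (n - 1) / 2)) -
    6 * d * (α * (n * (n - 1) / 2)) + d ^ 2 := by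
  obtain ⟨e, e1, e2, e11, e12, e22⟩ := jack_moments hα n
  rw [sum_congr rfl fun lam _ => congrArg (jackP α lam * ·) (show _ =
    d ^ 2 + 2 * c * d * contentSum α lam + -6 * d * contentSqSum α lam +
      c ^ 2 * contentSum α lam ^ 2 + -6 * c * (contentSum α lam * contentSqSum α lam) +
      9 * contentSqSum α lam ^ 2 by ring), sum_jackP_poly, e, e1, e2, e11, e12, e22]
  ring

end Expectations

/-- Exact formula for the first Stein error term (Proposition 8 of the paper). -/
theorem stein_first_error_term (α : ℝ) (hα : 1 ≤ α) (n : ℕ) (hn : 2 ≤ n) :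
    (∑ lam : n.Partition, jackP α lam *
        (-1 + (n : ℝ) / 4 *
          ∑ rho : n.Partition, M α lam rho * (W α rho - W α lam) ^ 2) ^ 2) =
      (3 * α * n + 2 * α ^ 2 - 10 * α + 2) / (4 * α * n * (n - 1)) := by
  obtain ⟨m, rfl⟩ : ∃ m, n = m + 1 := ⟨n - 1, by omega⟩
  have hα0 : 0 < α := by linarith
  have hm : (m : ℝ) ≠ 0 := by
    rw [Nat.cast_ne_zero]
    omega
  simp only [stein_term_eq hα0 (by omega : 1 ≤ m), div_pow, ← mul_div_assoc]
  rw [← sum_div, sum_jackP_sq_sub hα0]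
  push_cast
  rw [add_sub_cancel_right]
  field_simp
  ring

end JackTest
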